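/- Let B be a finite left regular band monoid, G a finite group acting on B by monoid automorphisms, and k a field whose characteristic does not divide |G| (encoded as (|G| : k) ≠ 0). Then the following are equivalent: (1) the invariant subalgebra (kB)^G of the monoid algebra kB is a semisimple ring; (2) the number of G-orbits on the support semilattice Λ(B) equals the number of G-orbits on B; (3) (kB)^G is commutative. -/

import Mathlib

/-!
Statement 0. Let `B` be a finite left regular band monoid (a finite monoid satisfying
`x*x = x` and `x*y*x = x*y`), `G` a finite group acting on `B` by monoid automorphisms,
and `k` a field whose characteristic does not divide `|G|`.  Then the following are
equivalent: (1) the invariant subalgebra `(kB)^G` is a semisimple ring; (2) the number of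
`G`-orbits on the support semilattice `Λ(B)` equals the number of `G`-orbits on `B`;
(3) `(kB)^G` is commutative.
-/

/-- The action of `g : G` on the monoid algebra `k[B]`, permuting the basis `B`. -/
noncomputable def gAct (k : Type*) [Field k] (B G : Type*) [Monoid B] [Group G]
    [MulDistribMulAction G B] (g : G) :
    MonoidAlgebra k B ≃ₐ[k] MonoidAlgebra k B :=
  MonoidAlgebra.domCongr k k (MulDistribMulAction.toMulEquiv B g)

/-- The invariant subalgebra `(k[B])^G` of the monoid algebra. -/
noncomputable def invAlg (k : Type*) [Field k] (B G : Type*) [Monoid B] [Group G]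
    [MulDistribMulAction G B] : Subalgebra k (MonoidAlgebra k B) where
  carrier := {x | ∀ g : G, gAct k B G g x = x}
  mul_mem' := by
    intro a b ha hb g
    rw [map_mul, ha g, hb g]
  add_mem' := by
    intro a b ha hb g
    rw [map_add, ha g, hb g]
  algebraMap_mem' := fun r g => (gAct k B G g).commutes r

namespace LRBInv

open Classical MonoidAlgebra

section

variable {k B G : Type*} [Field k] [Monoid B] [Fintype B] [Group G] [Fintype G]
    [MulDistribMulAction G B]

/-- The character `b' ↦ [σ(b) ≤ σ(b')]` of `B`. -/
noncomputable def chi (k : Type*) [Field k] {B : Type*} [Monoid B]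
    (hlrb : ∀ x y : B, x * y * x = x * y) (b : B) : B →* k where
  toFun c := if b * c = b then 1 else 0
  map_one' := by simp
  map_mul' c d := by
    have h : b * (c * d) = b ↔ b * c = b ∧ b * d = b := by
      constructor
      · intro h
        have hc : b * c = b := by
          calc b * c = b * (c * d) * c := by rw [h]
            _ = b * (c * d * c) := by rw [mul_assoc]
            _ = b * (c * d) := by rw [hlrb]
            _ = b := h
        refine ⟨hc, ?_⟩
        rw [← mul_assoc, hc] at h
        exact h
      · rintro ⟨h1, h2⟩
        rw [← mul_assoc, h1, h2]
    by_cases h1 : b * c = b <;> by_cases h2 : b * d = b <;> simp [h, h1, h2]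

/-- All characters together. -/
noncomputable def Phi (k : Type*) [Field k] {B : Type*} [Monoid B]
    (hlrb : ∀ x y : B, x * y * x = x * y) : MonoidAlgebra k B →ₐ[k] (B → k) :=
  AlgHom.pi (fun b => MonoidAlgebra.lift k k B (chi k hlrb b))

theorem Phi_apply (hlrb : ∀ x y : B, x * y * x = x * y) (x : MonoidAlgebra k B) (b : B) :
    Phi k hlrb x b = ∑ c, if b * c = b then x.coeff c else 0 := by
  have : Phi k hlrb x b = MonoidAlgebra.lift k k B (chi k hlrb b) x := rfl
  rw [this, MonoidAlgebra.lift_apply, Finsupp.sum_fintype _ _ (by simp)]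
  refine Finset.sum_congr rfl fun c _ => ?_
  simp [chi]

theorem rank_lt (hidem : ∀ x : B, x * x = x) (hlrb : ∀ x y : B, x * y * x = x * y)
    (b c : B) (h : b * c ≠ b) :
    (Finset.univ.filter fun d : B => d * (b * c) = d).card <
      (Finset.univ.filter fun d : B => d * b = d).card := by
  apply Finset.card_lt_card
  rw [Finset.ssubset_iff_of_subset]
  · refine ⟨b, by simp [hidem], ?_⟩
    simp [← mul_assoc, hidem, h]
  · intro d hd
    simp only [Finset.mem_filter, Finset.mem_univ, true_and] at hd ⊢
    calc d * b = d * (b * c) * b := by rw [hd]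
      _ = d * (b * c * b) := by rw [mul_assoc]
      _ = d := by rw [hlrb, hd]

theorem sum_single_eq (x : MonoidAlgebra k B) : x = ∑ c, single c (x.coeff c) := by
  conv_lhs => rw [← MonoidAlgebra.sum_coeff_single x]
  rw [Finsupp.sum_fintype _ _ (by simp)]

theorem single_mul_pow (hidem : ∀ x : B, x * x = x) (hlrb : ∀ x y : B, x * y * x = x * y)
    (x : MonoidAlgebra k B) (hx : Phi k hlrb x = 0) (n : ℕ) :
    ∀ b : B, (Finset.univ.filter fun d : B => d * b = d).card ≤ n →
      ∀ r : k, single b r * x ^ n = 0 := by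
  induction n with
  | zero =>
    intro b hb
    exfalso
    have : b ∈ (Finset.univ.filter fun d : B => d * b = d) := by simp [hidem]
    have := Finset.card_pos.2 ⟨b, this⟩
    omega
  | succ n ih =>
    intro b hb r
    have h1 : single b r * x = ∑ c, if b * c = b then 0 else single (b * c) (r * x.coeff c) := by
      have h2 : single b r * x = ∑ c, single (b * c) (r * x.coeff c) := by
        conv_lhs => rw [sum_single_eq x]
        rw [Finset.mul_sum]
        simp [single_mul_single]
      have h3 : ∑ c, (if b * c = b then single (b * c) (r * x.coeff c) else 0) = 0 := by
        have h4 := congrFun hx b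
        rw [Phi_apply] at h4
        have : ∑ c, (if b * c = b then single (b * c) (r * x.coeff c) else 0)
            = ∑ c, single b (r * (if b * c = b then x.coeff c else 0)) := by
          refine Finset.sum_congr rfl fun c _ => ?_
          split_ifs with h
          · rw [h]
          · simp
        rw [this]
        have h5 : ∀ f : B → k, ∑ c, single b (f c) = (single b (∑ c, f c) : MonoidAlgebra k B) := by
          intro f
          exact (map_sum (MonoidAlgebra.singleAddHom b) f _).symm
        rw [h5, ← Finset.mul_sum, h4]
        simp
      rw [h2, ← sub_eq_zero, ← Finset.sum_sub_distrib]
      refine Eq.trans ?_ h3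
      refine Finset.sum_congr rfl fun c _ => ?_
      split_ifs <;> simp
    rw [pow_succ', ← mul_assoc, h1, Finset.sum_mul]
    refine Finset.sum_eq_zero fun c _ => ?_
    split_ifs with h
    · simp
    · exact ih _ (by have := rank_lt hidem hlrb b c h; omega) _

theorem isNilpotent_of_ker (hidem : ∀ x : B, x * x = x) (hlrb : ∀ x y : B, x * y * x = x * y)
    (x : MonoidAlgebra k B) (hx : Phi k hlrb x = 0) : IsNilpotent x :=
  ⟨_, by simpa [← MonoidAlgebra.one_def] using single_mul_pow hidem hlrb x hx _ 1 le_rfl 1⟩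

theorem mem_inv (x : MonoidAlgebra k B) (hx : x ∈ invAlg k B G) (g : G) (b : B) :
    x.coeff (g • b) = x.coeff b := by
  have h : gAct k B G g x = x := hx g
  conv_lhs => rw [← h]
  rw [gAct, MonoidAlgebra.coeff_domCongr]
  congr 1
  exact (MulDistribMulAction.toMulEquiv B g).symm_apply_apply b

/-- orbit sum -/
noncomputable def orb (k : Type*) [Field k] {B : Type*} (G : Type*) [Monoid B] [Group G] [Fintype G]
    [MulDistribMulAction G B] (b : B) : MonoidAlgebra k B := ∑ g : G, single (g • b) 1

theorem orb_mem (b : B) : orb k G b ∈ invAlg k B G := by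
  intro h
  simp only [orb, map_sum, gAct, MonoidAlgebra.domCongr_single]
  refine Fintype.sum_equiv (Equiv.mulLeft h) _ _ fun g => ?_
  simp [mul_smul]

/-- The stabilizer of the support of `a`. -/
noncomputable def stabS (G : Type*) {B : Type*} [Monoid B] [Group G] [Fintype G]
    [MulDistribMulAction G B] (hidem : ∀ x : B, x * x = x) (a : B) : Subgroup G :=
  let S : Submonoid G :=
    { carrier := {g | a * (g • a) = a}
      one_mem' := by simp [hidem]
      mul_mem' := by
        intro g h hg hh
        simp only [Set.mem_setOf_eq] at hg hh ⊢
        have h1 : (g • a) * ((g * h) • a) = g • a := by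
          rw [mul_smul, ← smul_mul', hh]
        calc a * ((g * h) • a) = a * (g • a) * ((g * h) • a) := by rw [hg]
          _ = a := by rw [mul_assoc, h1, hg] }
  { S with
    inv_mem' := by
      intro g hg
      have : g⁻¹ = g ^ (orderOf g - 1) := by
        apply inv_eq_of_mul_eq_one_right
        rw [← pow_succ', Nat.sub_add_cancel (orderOf_pos g), pow_orderOf_eq_one]
      rw [this]
      exact S.pow_mem hg _ }

theorem mem_stabS (hidem : ∀ x : B, x * x = x) (a : B) (g : G) :
    g ∈ stabS G hidem a ↔ a * (g • a) = a := Iff.rfl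

theorem stabS_symm (hidem : ∀ x : B, x * x = x) (a : B) (g : G) (h : a * (g • a) = a) :
    (g • a) * a = g • a := by
  have := (stabS G hidem a).inv_mem ((mem_stabS hidem a g).2 h)
  rw [mem_stabS] at this
  have h2 := congrArg (g • ·) this
  simpa [smul_mul'] using h2

theorem cast_ne (hchar : (Fintype.card G : k) ≠ 0) (d : ℕ) (hd : d ∣ Nat.card G) :
    (d : k) ≠ 0 := by
  rintro h
  obtain ⟨e, he⟩ := hd
  apply hchar
  rw [← Nat.card_eq_fintype_card, he, Nat.cast_mul, h, zero_mul]

theorem sum_sub_ne (hchar : (Fintype.card G : k) ≠ 0) (K : Subgroup G)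
    [DecidablePred (fun g => g ∈ K)] :
    (∑ g : G, if g ∈ K then (1 : k) else 0) ≠ 0 := by
  rw [Finset.sum_boole]
  have : (Finset.univ.filter fun g => g ∈ K).card = Nat.card K := by
    rw [Nat.card_eq_fintype_card, Fintype.card_subtype]
  rw [this]
  exact cast_ne hchar _ K.card_subgroup_dvd_card

theorem orb_mul_coeff (a b c : B) : (orb k G a * orb k G b).coeff c =
    ∑ h : G, ∑ g : G, if (h • a) * (g • b) = c then (1 : k) else 0 := by
  simp only [orb, Finset.sum_mul_sum, single_mul_single, MonoidAlgebra.coeff_sum,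
    Finsupp.finset_sum_apply, MonoidAlgebra.coeff_single_apply, mul_one]

/-- Commutativity implies that elements with the same support are in the same orbit. -/
theorem transitive_of_comm (hidem : ∀ x : B, x * x = x) (hlrb : ∀ x y : B, x * y * x = x * y)
    (hchar : (Fintype.card G : k) ≠ 0) (hcomm : ∀ x y : invAlg k B G, x * y = y * x)
    (a b : B) (hab : a * b = a) (hba : b * a = b) : ∃ g : G, g • a = b := by
  by_contra hne
  push Not at hne
  have hc : orb k G a * orb k G b = orb k G b * orb k G a :=
    congrArg Subtype.val (hcomm ⟨_, orb_mem a⟩ ⟨_, orb_mem b⟩)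
  have hc2 := congrArg (fun x => x.coeff a) hc
  simp only [orb_mul_coeff] at hc2
  -- support comparisons
  have key : ∀ g : G, a * (g • b) = a ↔ a * (g • a) = a := by
    intro g
    have h1 : (g • b) * (g • a) = g • b := by rw [← smul_mul', hba]
    have h2 : (g • a) * (g • b) = g • a := by rw [← smul_mul', hab]
    constructor
    · intro h
      calc a * (g • a) = a * (g • b) * (g • a) := by rw [h]
        _ = a := by rw [mul_assoc, h1, h]
    · intro h
      calc a * (g • b) = a * (g • a) * (g • b) := by rw [h]
        _ = a := by rw [mul_assoc, h2, h]
  have prod : ∀ u v : B, u * v = a → u * a = a ∧ a * u = a := by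
    intro u v h
    constructor
    · rw [← h, ← mul_assoc, hidem]
    · rw [← h, hlrb]
  have hright : ∑ h : G, ∑ g : G, (if (h • b) * (g • a) = a then (1 : k) else 0) = 0 := by
    refine Finset.sum_eq_zero fun h _ => Finset.sum_eq_zero fun g _ => ?_
    rw [if_neg]
    intro e
    obtain ⟨e1, e2⟩ := prod _ _ e
    have e3 := stabS_symm hidem a h ((key h).1 e2)
    have e4 : (h • b) * a = h • b := by
      calc (h • b) * a = (h • b) * (h • a) * a := by rw [← smul_mul', hba]
        _ = h • b := by rw [mul_assoc, e3, ← smul_mul', hba]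
    apply hne h⁻¹
    rw [inv_smul_eq_iff, ← e4, e1]
  have hleft : ∑ h : G, ∑ g : G, (if (h • a) * (g • b) = a then (1 : k) else 0) =
      (∑ h : G, if h ∈ MulAction.stabilizer G a then (1 : k) else 0) *
      (∑ g : G, if g ∈ stabS G hidem a then (1 : k) else 0) := by
    rw [Finset.sum_mul_sum]
    refine Finset.sum_congr rfl fun h _ => Finset.sum_congr rfl fun g _ => ?_
    have : (h • a) * (g • b) = a ↔ h • a = a ∧ a * (g • a) = a := by
      constructor
      · intro e
        obtain ⟨e1, e2⟩ := prod _ _ e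
        have e3 := stabS_symm hidem a h e2
        have e4 : h • a = a := e3.symm.trans e1
        rw [e4, key] at e
        exact ⟨e4, e⟩
      · rintro ⟨e1, e2⟩
        rw [e1, key, e2]
    simp only [MulAction.mem_stabilizer_iff, mem_stabS]
    by_cases h1 : h • a = a <;> by_cases h2 : a * (g • a) = a <;> simp [h1, h2, key] <;>
      simp [this, h1]
  rw [hright, hleft] at hc2
  exact mul_ne_zero (sum_sub_ne hchar _) (sum_sub_ne hchar _) hc2

/-- Transitivity implies injectivity of `Phi` on the invariants. -/
theorem inj_of_transitive (hidem : ∀ x : B, x * x = x) (hlrb : ∀ x y : B, x * y * x = x * y)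
    (hchar : (Fintype.card G : k) ≠ 0)
    (htr : ∀ a b : B, a * b = a → b * a = b → ∃ g : G, g • a = b)
    (x : MonoidAlgebra k B) (hx : x ∈ invAlg k B G) (h0 : Phi k hlrb x = 0) : x = 0 := by
  by_contra hne
  have hsupp : x.coeff.support.Nonempty := by
    rw [Finsupp.support_nonempty_iff]
    simpa using hne
  obtain ⟨b, hb, hmax⟩ := Finset.exists_max_image x.coeff.support
    (fun b => (Finset.univ.filter fun d : B => d * b = d).card) hsupp
  have h1 := congrFun h0 b
  rw [Phi_apply] at h1
  have h2 : ∀ c, (if b * c = b then x.coeff c else 0) =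
      (if c ∈ MulAction.orbit (stabS G hidem b) b then (1 : k) else 0) * x.coeff b := by
    intro c
    by_cases hc : c ∈ MulAction.orbit (stabS G hidem b) b
    · obtain ⟨⟨g, hg⟩, rfl⟩ := hc
      rw [mem_stabS] at hg
      have e1 : (fun m : stabS G hidem b => m • b) ⟨g, hg⟩ = g • b := rfl
      simp only [e1, hg, if_true, mem_inv x hx, one_mul]
      rw [if_pos, one_mul]
      exact ⟨⟨g, hg⟩, rfl⟩
    · rw [if_neg hc, zero_mul]
      split_ifs with h3
      · by_contra h4
        apply hc
        have h5 := hmax c (by simpa using h4)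
        have hsub : (Finset.univ.filter fun d : B => d * b = d) ⊆
            (Finset.univ.filter fun d : B => d * c = d) := by
          intro d hd
          simp only [Finset.mem_filter, Finset.mem_univ, true_and] at hd ⊢
          calc d * c = d * b * c := by rw [hd]
            _ = d := by rw [mul_assoc, h3, hd]
        have h6 := Finset.eq_of_subset_of_card_le hsub h5
        have h7 : c ∈ (Finset.univ.filter fun d : B => d * b = d) := by
          rw [h6]; simp [hidem]
        have h8 : c * b = c := by simpa using h7
        obtain ⟨g, rfl⟩ := htr b c h3 h8
        exact ⟨⟨g, h3⟩, rfl⟩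
      · rfl
  rw [Finset.sum_congr rfl (fun c _ => h2 c), ← Finset.sum_mul, Finset.sum_boole] at h1
  rcases mul_eq_zero.1 h1 with h3 | h3
  · refine cast_ne hchar _ ?_ h3
    have h4 : (Finset.univ.filter fun c => c ∈ MulAction.orbit (stabS G hidem b) b).card =
        Nat.card (MulAction.orbit (stabS G hidem b) b) := by
      rw [Nat.card_eq_fintype_card, Fintype.card_subtype]
    rw [h4]
    refine dvd_trans ?_ (stabS G hidem b).card_subgroup_dvd_card
    rw [Nat.card_eq_fintype_card, Nat.card_eq_fintype_card,
      ← MulAction.card_orbit_mul_card_stabilizer_eq_card_group (stabS G hidem b) b]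
    exact dvd_mul_right _ _
  · simp [h3] at hb

/-- `Phi` restricted to the invariants. -/
noncomputable def PhiG (k : Type*) [Field k] {B : Type*} (G : Type*) [Monoid B] [Group G]
    [MulDistribMulAction G B] (hlrb : ∀ x y : B, x * y * x = x * y) :
    invAlg k B G →ₐ[k] (B → k) := (Phi k hlrb).comp (invAlg k B G).val

theorem comm_of_inj (hlrb : ∀ x y : B, x * y * x = x * y)
    (h : Function.Injective (PhiG k G hlrb)) (x y : invAlg k B G) : x * y = y * x := by
  apply h
  rw [map_mul, map_mul, mul_comm]

theorem inj_of_semisimple (hidem : ∀ x : B, x * x = x) (hlrb : ∀ x y : B, x * y * x = x * y)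
    (hs : IsSemisimpleRing (invAlg k B G)) : Function.Injective (PhiG k G hlrb) := by
  rw [injective_iff_map_eq_zero]
  intro x hx
  obtain ⟨e, he, hI⟩ := IsSemisimpleRing.ideal_eq_span_idempotent (Ideal.span {x})
  have hmem : e ∈ Ideal.span {x} := by rw [hI]; exact Ideal.subset_span rfl
  obtain ⟨r, rfl⟩ := Ideal.mem_span_singleton'.1 hmem
  have h1 : PhiG k G hlrb (r * x) = 0 := by rw [map_mul, hx, mul_zero]
  obtain ⟨n, hn⟩ := isNilpotent_of_ker hidem hlrb (r * x : invAlg k B G).1 h1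
  have h2 : r * x = 0 := by
    have h3 : (r * x) ^ (n + 1) = 0 := by
      apply Subtype.ext
      rw [SubmonoidClass.coe_pow, pow_succ, hn, zero_mul]
      rfl
    rwa [he.pow_succ_eq] at h3
  have h4 : x ∈ Ideal.span {x} := Ideal.subset_span rfl
  rw [hI, h2] at h4
  simpa using h4

theorem semisimple_of_inj (hlrb : ∀ x y : B, x * y * x = x * y)
    (h : Function.Injective (PhiG k G hlrb)) : IsSemisimpleRing (invAlg k B G) := by
  have : IsReduced (invAlg k B G) := isReduced_of_injective (PhiG k G hlrb) h
  have : FiniteDimensional k (invAlg k B G) :=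
    FiniteDimensional.of_injective (PhiG k G hlrb).toLinearMap h
  have : IsArtinianRing (invAlg k B G) := IsArtinianRing.of_finite k _
  letI : CommRing (invAlg k B G) :=
    { (inferInstance : Ring (invAlg k B G)) with mul_comm := comm_of_inj hlrb h }
  exact IsArtinianRing.isSemisimpleRing_of_isReduced (invAlg k B G)

end

end LRBInv

theorem stmt0 (k B G : Type*) [Field k] [Monoid B] [Fintype B] [Group G] [Fintype G]
    [MulDistribMulAction G B]
    (hidem : ∀ x : B, x * x = x) (hlrb : ∀ x y : B, x * y * x = x * y)
    (hchar : (Fintype.card G : k) ≠ 0) :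
    List.TFAE
      [ -- (1) the invariant subalgebra is semisimple
        IsSemisimpleRing (invAlg k B G),
        -- (2) `|Λ(B)/G| = |B/G|` : the number of `G`-orbits of supports
        -- (where `σ(a) = σ(b)` is spelled `a*b = a ∧ b*a = b`)
        -- equals the number of `G`-orbits on `B`
        Nat.card (Quot (fun a b : B => ∃ g : G, (g • a) * b = g • a ∧ b * (g • a) = b)) =
          Nat.card (Quot (fun a b : B => ∃ g : G, g • a = b)),
        -- (3) the invariant subalgebra is commutative
        ∀ x y : invAlg k B G, x * y = y * x ] := by
  have h13 : IsSemisimpleRing (invAlg k B G) → ∀ x y : invAlg k B G, x * y = y * x := fun h =>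
    LRBInv.comm_of_inj hlrb (LRBInv.inj_of_semisimple hidem hlrb h)
  tfae_have 1 → 3 := h13
  tfae_have 3 → 2 := by
    intro h
    have htr := LRBInv.transitive_of_comm hidem hlrb hchar h
    have : (fun a b : B => ∃ g : G, (g • a) * b = g • a ∧ b * (g • a) = b) =
        (fun a b : B => ∃ g : G, g • a = b) := by
      funext a b
      apply propext
      constructor
      · rintro ⟨g, h1, h2⟩
        obtain ⟨g', h3⟩ := htr _ _ h1 h2
        exact ⟨g' * g, by rw [mul_smul, h3]⟩
      · rintro ⟨g, rfl⟩
        exact ⟨g, hidem _, hidem _⟩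
    rw [this]
  tfae_have 2 → 1 := by
    intro h
    have heqv : Equivalence (fun a b : B => ∃ g : G, g • a = b) :=
      ⟨fun a => ⟨1, one_smul _ _⟩, fun {a b} ⟨g, hg⟩ => ⟨g⁻¹, by rw [← hg, inv_smul_smul]⟩,
        fun {a b c} ⟨g, hg⟩ ⟨g', hg'⟩ => ⟨g' * g, by rw [mul_smul, hg, hg']⟩⟩
    let f : Quot (fun a b : B => ∃ g : G, g • a = b) →
        Quot (fun a b : B => ∃ g : G, (g • a) * b = g • a ∧ b * (g • a) = b) :=
      Quot.map id (by rintro a b ⟨g, rfl⟩; exact ⟨g, hidem _, hidem _⟩)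
    have hf : Function.Surjective f := by
      rintro ⟨a⟩
      exact ⟨Quot.mk _ a, rfl⟩
    have hinj := (hf.bijective_of_nat_card_le h.ge).1
    have htr : ∀ a b : B, a * b = a → b * a = b → ∃ g : G, g • a = b := by
      intro a b h1 h2
      have h3 : f (Quot.mk _ a) = f (Quot.mk _ b) :=
        Quot.sound ⟨1, by simpa using h1, by simpa using h2⟩
      exact (heqv.quot_mk_eq_iff a b).1 (hinj h3)
    apply LRBInv.semisimple_of_inj hlrb
    rw [injective_iff_map_eq_zero]
    intro x hx
    exact Subtype.ext (LRBInv.inj_of_transitive hidem hlrb hchar htr x.1 x.2 hx)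
  tfae_finish
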